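/- For every R ≥ 1 there is a constant C depending only on n and R such that for every integer j ≥ 1 and all 0 < y ≤ 2R, c_j |φ_j(y)| ≤ C · j^{(n − 3 + 2α)/4} · y^α. -/

import Mathlib

open Set MeasureTheory

section KummerPolynomial

open Polynomial

/-- The coefficient of `x ^ m` in the Kummer polynomial `M(-j, b; x)`. -/
noncomputable def kummerCoeff (b : ℝ) (j m : ℕ) : ℝ :=
  (-1) ^ m * (j.choose m : ℝ) / ∏ k ∈ Finset.range m, (b + (k : ℝ))

/-- The Kummer polynomial `M(-j, b; X)`. -/
noncomputable def kummerPoly (b : ℝ) (j : ℕ) : ℝ[X] :=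
  ∑ m ∈ Finset.range (j + 1), C (kummerCoeff b j m) * X ^ m

lemma prod_add_natCast_pos {b : ℝ} (hb : 0 < b) (m : ℕ) :
    0 < ∏ k ∈ Finset.range m, (b + (k : ℝ)) :=
  Finset.prod_pos fun k _ ↦ by positivity

lemma eval_kummerPoly (b : ℝ) (j : ℕ) (x : ℝ) :
    (kummerPoly b j).eval x = ∑ m ∈ Finset.range (j + 1), kummerCoeff b j m * x ^ m := by
  simp [kummerPoly, eval_finsetSum]

lemma coeff_kummerPoly (b : ℝ) (j m : ℕ) : (kummerPoly b j).coeff m = kummerCoeff b j m := by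
  simp only [kummerPoly, finsetSum_coeff, coeff_C_mul_X_pow]
  rw [Finset.sum_ite_eq]
  split_ifs with h
  · rfl
  · have : j < m := by
      rw [Finset.mem_range] at h
      omega
    simp [kummerCoeff, Nat.choose_eq_zero_of_lt this]

lemma kummerCoeff_succ {b : ℝ} (hb : 0 < b) (j m : ℕ) :
    (m + 1) * (b + m) * kummerCoeff b j (m + 1) = (m - j) * kummerCoeff b j m := by
  have hch : (j.choose (m + 1) : ℝ) * (m + 1) = j.choose m * (j - m) := by
    rcases le_or_gt m j with h | h
    · have := Nat.choose_succ_right_eq j m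
      rw [← Nat.cast_sub h]
      exact_mod_cast this
    · simp [Nat.choose_eq_zero_of_lt h, Nat.choose_eq_zero_of_lt (h.trans (Nat.lt_succ_self m))]
  have h1 := (prod_add_natCast_pos hb m).ne'
  have h2 : b + m ≠ 0 := by positivity
  rw [kummerCoeff, kummerCoeff, Finset.prod_range_succ]
  field_simp
  rw [pow_succ]
  linear_combination (-1 : ℝ) ^ m * (-1) * hch

/-- Kummer's differential equation. -/
lemma kummerPoly_ode {b : ℝ} (hb : 0 < b) (j : ℕ) :
    X * derivative (derivative (kummerPoly b j)) + (C b - X) * derivative (kummerPoly b j)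
      + C (j : ℝ) * kummerPoly b j = 0 := by
  ext m
  rcases m with _ | m
  · have := kummerCoeff_succ hb j 0
    simp only [sub_mul, mul_coeff_zero, coeff_derivative, coeff_kummerPoly, coeff_add, coeff_sub,
      coeff_X_zero, coeff_C_zero, coeff_zero] at this ⊢
    push_cast at this ⊢
    linarith
  · have := kummerCoeff_succ hb j (m + 1)
    simp only [sub_mul, coeff_add, coeff_sub, coeff_X_mul, coeff_C_mul, coeff_derivative,
      coeff_kummerPoly, coeff_zero] at this ⊢
    push_cast at this ⊢
    linear_combination this

lemma abs_eval_kummerPoly_le {b : ℝ} (hb : 1 ≤ b) {j : ℕ} (hj : 1 ≤ j) {s : ℝ} (hs : 0 ≤ s) :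
    |(kummerPoly b j).eval s| ≤ Real.exp s := by
  set P := kummerPoly b j with hP
  have hj' : (0 : ℝ) < j := by exact_mod_cast hj
  have hode (x : ℝ) := congrArg (eval x) (kummerPoly_ode (zero_lt_one.trans_le hb) j)
  simp only [eval_add, eval_mul, eval_sub, eval_X, eval_C, eval_zero, ← hP] at hode
  let E : ℝ → ℝ := fun x ↦
    Real.exp (-2 * x) * (P.eval x ^ 2 + x / j * (derivative P).eval x ^ 2)
  have hE (x : ℝ) : HasDerivAt E (-Real.exp (-2 * x) *
      (2 * P.eval x ^ 2 + (2 * b - 1) / j * (derivative P).eval x ^ 2)) x := by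
    have h1 : HasDerivAt (fun x : ℝ ↦ Real.exp (-2 * x)) (Real.exp (-2 * x) * (-2)) x := by
      simpa using ((hasDerivAt_id x).const_mul (-2 : ℝ)).exp
    have h2 := (P.hasDerivAt x).fun_pow 2
    have h3 := ((hasDerivAt_id' x).div_const (j : ℝ)).mul
      (((derivative P).hasDerivAt x).fun_pow 2)
    refine (h1.mul (h2.add h3)).congr_deriv ?_
    simp only [Pi.add_apply, Pi.mul_apply]
    field_simp
    linear_combination 2 * (derivative P).eval x * hode x
  have hanti : AntitoneOn E (Ici 0) := by
    refine antitoneOn_of_deriv_nonpos (convex_Ici 0)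
      (fun x _ ↦ (hE x).continuousAt.continuousWithinAt)
      (fun x _ ↦ (hE x).differentiableAt.differentiableWithinAt) fun x _ ↦ ?_
    rw [(hE x).deriv, neg_mul, neg_nonpos]
    have : 0 ≤ 2 * b - 1 := by linarith
    positivity
  have h0 : P.eval 0 = 1 := by
    rw [← coeff_zero_eq_eval_zero, hP, coeff_kummerPoly]
    simp [kummerCoeff]
  have hle : E s ≤ 1 := by
    have := hanti (mem_Ici.2 le_rfl) (mem_Ici.2 hs) hs
    simpa [E, h0] using this
  have hsq : P.eval s ^ 2 ≤ Real.exp s ^ 2 := by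
    have hx : Real.exp (-2 * s) * Real.exp s ^ 2 = 1 := by
      rw [← Real.exp_nat_mul, ← Real.exp_add]
      simp
    have hnn : 0 ≤ s / j * (derivative P).eval s ^ 2 := by positivity
    have hpos := Real.exp_pos (-2 * s)
    refine le_of_mul_le_mul_left ?_ hpos
    rw [hx]
    refine le_trans ?_ hle
    exact mul_le_mul_of_nonneg_left (by linarith) hpos.le
  exact abs_le_of_sq_le_sq hsq (Real.exp_pos s).le

lemma ascPochhammer_eval_eq_prod_range (b : ℝ) (k : ℕ) :
    (ascPochhammer ℝ k).eval b = ∏ i ∈ Finset.range k, (b + (i : ℝ)) := by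
  induction k with
  | zero => simp
  | succ k ih => rw [ascPochhammer_succ_eval, ih, Finset.prod_range_succ]

lemma Gamma_add_natCast_eq_ascPochhammer {b : ℝ} (hb : 0 < b) (k : ℕ) :
    Real.Gamma (b + k) = (ascPochhammer ℝ k).eval b * Real.Gamma b := by
  induction k with
  | zero => simp
  | succ k ih =>
    rw [ascPochhammer_succ_eval, Nat.cast_succ, ← add_assoc,
      Real.Gamma_add_one (by positivity), ih]
    ring

/-- The moments of `M(-j, b; x)` against `x ^ (b - 1) * exp (-x)` as a finite difference. -/
lemma sum_kummerCoeff_mul_Gamma {b : ℝ} (hb : 0 < b) (j k : ℕ) :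
    ∑ m ∈ Finset.range (j + 1), kummerCoeff b j m * Real.Gamma (b + (k + m : ℕ)) =
      (-1) ^ j * Real.Gamma b *
        (fwdDiff 1)^[j] (((ascPochhammer ℝ k).comp (X + C b)).eval) 0 := by
  rw [fwdDiff_iter_eq_sum_shift, Finset.mul_sum]
  refine Finset.sum_congr rfl fun m hm ↦ ?_
  have hmj : m ≤ j := Nat.lt_succ_iff.1 (Finset.mem_range.1 hm)
  have h1 := (prod_add_natCast_pos hb m).ne'
  have hsign : (-1 : ℝ) ^ j * (-1) ^ (j - m) = (-1) ^ m := by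
    rw [← pow_add, show j + (j - m) = 2 * (j - m) + m by omega, pow_add, pow_mul]
    simp
  rw [show b + ((k + m : ℕ) : ℝ) = (b + m) + k by push_cast; ring,
    Gamma_add_natCast_eq_ascPochhammer (by positivity), Gamma_add_natCast_eq_ascPochhammer hb,
    ascPochhammer_eval_eq_prod_range b m, kummerCoeff]
  simp only [zsmul_eq_mul, nsmul_eq_mul, mul_one, zero_add, eval_comp, eval_add, eval_X, eval_C]
  push_cast
  rw [← hsign, add_comm (m : ℝ) b]
  field_simp

lemma natDegree_ascPochhammer_comp (b : ℝ) (k : ℕ) :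
    ((ascPochhammer ℝ k).comp (X + C b)).natDegree = k := by
  rw [natDegree_comp, ascPochhammer_natDegree, natDegree_X_add_C, mul_one]

/-- The squared weighted norm of `M(-j, b; x)`, expanded by coefficients. -/
lemma sum_kummerCoeff_mul_kummerCoeff_mul_Gamma {b : ℝ} (hb : 0 < b) (j : ℕ) :
    ∑ k ∈ Finset.range (j + 1), ∑ m ∈ Finset.range (j + 1),
      kummerCoeff b j k * kummerCoeff b j m * Real.Gamma (b + (k + m : ℕ)) =
      Real.Gamma b * j.factorial / ∏ k ∈ Finset.range j, (b + (k : ℝ)) := by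
  simp_rw [mul_assoc, ← Finset.mul_sum, sum_kummerCoeff_mul_Gamma hb]
  rw [Finset.sum_range_succ, Finset.sum_eq_zero, zero_add]
  · have h := fwdDiff_iter_degree_eq_factorial ((ascPochhammer ℝ j).comp (X + C b))
    rw [natDegree_ascPochhammer_comp,
      ((monic_ascPochhammer ℝ j).comp_X_add_C b).leadingCoeff] at h
    rw [h, kummerCoeff]
    have hs : (-1 : ℝ) ^ j * (-1) ^ j = 1 := by rw [← mul_pow]; simp
    simp only [Nat.choose_self, one_smul, Nat.cast_one, mul_one, Pi.natCast_apply]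
    linear_combination (Real.Gamma b * j.factorial / ∏ k ∈ Finset.range j, (b + (k : ℝ))) * hs
  · intro k hk
    rw [fwdDiff_iter_eq_zero_of_degree_lt]
    · simp
    · rw [natDegree_ascPochhammer_comp]
      exact Finset.mem_range.1 hk

lemma prod_add_natCast_le {b : ℝ} (hb : 1 ≤ b) {j : ℕ} (hj : 1 ≤ j) :
    ∏ k ∈ Finset.range j, (b + (k : ℝ)) ≤ Real.exp (b - 1) * (j : ℝ) ^ (b - 1) * j.factorial := by
  have hj' : (0 : ℝ) < j := by exact_mod_cast hj
  have hprod (i : ℕ) : ∏ k ∈ Finset.range i, (b + (k : ℝ)) ≤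
      Real.exp ((b - 1) * (harmonic i : ℝ)) * i.factorial := by
    induction i with
    | zero => simp
    | succ i ih =>
      rw [Finset.prod_range_succ, harmonic_succ, Nat.factorial_succ]
      push_cast
      have hi : (0 : ℝ) < i + 1 := by positivity
      have hstep : b + i ≤ Real.exp ((b - 1) * ((i : ℝ) + 1)⁻¹) * (i + 1) := by
        have := Real.add_one_le_exp ((b - 1) * ((i : ℝ) + 1)⁻¹)
        calc b + i = ((b - 1) * ((i : ℝ) + 1)⁻¹ + 1) * (i + 1) := by field_simp; ring
          _ ≤ _ := mul_le_mul_of_nonneg_right this hi.le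
      calc _ ≤ Real.exp ((b - 1) * (harmonic i : ℝ)) * i.factorial *
            (Real.exp ((b - 1) * ((i : ℝ) + 1)⁻¹) * (i + 1)) :=
            mul_le_mul ih hstep (by positivity) (by positivity)
        _ = _ := by rw [mul_add (b - 1), Real.exp_add]; ring
  refine (hprod j).trans (mul_le_mul_of_nonneg_right ?_ (by positivity))
  rw [Real.rpow_def_of_pos hj', ← Real.exp_add, Real.exp_le_exp]
  have := mul_le_mul_of_nonneg_left (harmonic_le_one_add_log j) (sub_nonneg.2 hb)
  linarith

lemma gaussian_moment_integrand_eq {b y : ℝ} (hy : 0 < y) (k : ℕ) :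
    (y ^ 2 / 4) ^ k * (y ^ (2 * b - 1) * Real.exp (-y ^ 2 / 4)) =
      (4 : ℝ)⁻¹ ^ k * (y ^ (2 * b - 1 + 2 * k) * Real.exp (-(4 : ℝ)⁻¹ * y ^ (2 : ℝ))) := by
  rw [Real.rpow_add hy, show (2 : ℝ) * k = ((2 * k : ℕ) : ℝ) by push_cast; ring,
    Real.rpow_natCast, Real.rpow_two, div_pow, ← pow_mul, inv_pow,
    show -y ^ 2 / 4 = -(4 : ℝ)⁻¹ * y ^ 2 by ring]
  ring

lemma integrableOn_gaussian_moment {b : ℝ} (hb : 0 < b) (k : ℕ) :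
    IntegrableOn (fun y : ℝ ↦ (y ^ 2 / 4) ^ k * (y ^ (2 * b - 1) * Real.exp (-y ^ 2 / 4)))
      (Ioi 0) := by
  refine IntegrableOn.congr_fun (Integrable.const_mul (integrableOn_rpow_mul_exp_neg_mul_rpow
    (p := 2) (s := 2 * b - 1 + 2 * k) (b := (4 : ℝ)⁻¹) ?_ two_pos (by norm_num)) _)
    (fun y hy ↦ (gaussian_moment_integrand_eq hy k).symm) measurableSet_Ioi
  have : (0 : ℝ) ≤ k := k.cast_nonneg
  linarith

lemma integral_gaussian_moment {b : ℝ} (hb : 0 < b) (k : ℕ) :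
    ∫ y in Ioi (0 : ℝ), (y ^ 2 / 4) ^ k * (y ^ (2 * b - 1) * Real.exp (-y ^ 2 / 4)) =
      4 ^ b / 2 * Real.Gamma (b + k) := by
  have hk : (0 : ℝ) ≤ k := k.cast_nonneg
  rw [setIntegral_congr_fun measurableSet_Ioi fun y hy ↦ gaussian_moment_integrand_eq hy k,
    integral_const_mul, integral_rpow_mul_exp_neg_mul_rpow two_pos (by linarith) (by norm_num),
    show (2 * b - 1 + 2 * k + 1) / 2 = b + k by ring,
    show -(2 * b - 1 + 2 * k + 1) / 2 = -(b + k) by ring, Real.inv_rpow (by norm_num),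
    Real.rpow_neg (by norm_num), inv_inv, Real.rpow_add (by norm_num), Real.rpow_natCast, inv_pow]
  field_simp

lemma integral_sq_eval_kummerPoly {b : ℝ} (hb : 0 < b) (j : ℕ) :
    ∫ y in Ioi (0 : ℝ), (kummerPoly b j).eval (y ^ 2 / 4) ^ 2 *
        (y ^ (2 * b - 1) * Real.exp (-y ^ 2 / 4)) =
      4 ^ b / 2 * (Real.Gamma b * j.factorial / ∏ k ∈ Finset.range j, (b + (k : ℝ))) := by
  have hexp (y : ℝ) : (kummerPoly b j).eval (y ^ 2 / 4) ^ 2 *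
      (y ^ (2 * b - 1) * Real.exp (-y ^ 2 / 4)) =
      ∑ k ∈ Finset.range (j + 1), ∑ m ∈ Finset.range (j + 1),
        kummerCoeff b j k * kummerCoeff b j m *
          ((y ^ 2 / 4) ^ (k + m) * (y ^ (2 * b - 1) * Real.exp (-y ^ 2 / 4))) := by
    rw [eval_kummerPoly, sq, Finset.sum_mul_sum, Finset.sum_mul]
    refine Finset.sum_congr rfl fun k _ ↦ ?_
    rw [Finset.sum_mul]
    refine Finset.sum_congr rfl fun m _ ↦ ?_
    ring
  have hintegral (k m : ℕ) := Integrable.const_mul (integrableOn_gaussian_moment hb (k + m))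
    (kummerCoeff b j k * kummerCoeff b j m)
  simp_rw [hexp]
  rw [integral_finsetSum _ fun k _ ↦ integrable_finsetSum _ fun m _ ↦ hintegral k m,
    ← sum_kummerCoeff_mul_kummerCoeff_mul_Gamma hb, Finset.mul_sum]
  refine Finset.sum_congr rfl fun k _ ↦ ?_
  rw [integral_finsetSum _ fun m _ ↦ hintegral k m, Finset.mul_sum]
  refine Finset.sum_congr rfl fun m _ ↦ ?_
  rw [integral_const_mul, integral_gaussian_moment hb]
  ring

end KummerPolynomial

/-- for every `R ≥ 1` there is `C = C(n, R)` such that for every `j ≥ 1` and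
`0 < y ≤ 2R`, `c_j |φ_j(y)| ≤ C j^{(n−3+2α)/4} y^α`, where `c_j > 0` is the normalizing
constant with `∫₀^∞ (c_j φ_j)² w = 1`. -/
theorem stmt_5 (n : ℕ) (hn : 8 ≤ n)
    (α b : ℝ)
    (hα : α = (3 - (n : ℝ) + Real.sqrt ((n : ℝ) ^ 2 - 10 * (n : ℝ) + 17)) / 2)
    (hb : b = α + ((n : ℝ) - 1) / 2)
    (φ : ℕ → ℝ → ℝ)
    (hφ : ∀ (i : ℕ) (y : ℝ), φ i y = y ^ α * ∑ m ∈ Finset.range (i + 1),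
      (-1 : ℝ) ^ m * (i.choose m : ℝ) * (y ^ 2 / 4) ^ m
        / ∏ k ∈ Finset.range m, (b + (k : ℝ)))
    (w : ℝ → ℝ)
    (hw : ∀ y : ℝ, w y = y ^ ((n : ℝ) - 2) * Real.exp (-y ^ 2 / 4)) :
    ∀ R : ℝ, 1 ≤ R → ∃ C : ℝ, 0 < C ∧ ∀ j : ℕ, 1 ≤ j → ∀ c : ℝ, 0 < c →
      (∫ y in Ioi (0 : ℝ), (c * φ j y) ^ 2 * w y) = 1 →
      ∀ y : ℝ, 0 < y → y ≤ 2 * R →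
        c * |φ j y| ≤ C * (j : ℝ) ^ (((n : ℝ) - 3 + 2 * α) / 4) * y ^ α := by
  intro R hR
  have hb1 : 1 ≤ b := by
    rw [hb, hα]
    have := Real.sqrt_nonneg ((n : ℝ) ^ 2 - 10 * (n : ℝ) + 17)
    linarith
  have hb0 : 0 < b := zero_lt_one.trans_le hb1
  set K : ℝ := 4 ^ b / 2 * Real.Gamma b with hK
  have hKpos : 0 < K := by
    have := Real.Gamma_pos_of_pos hb0
    positivity
  have hφP (j : ℕ) (y : ℝ) : φ j y = y ^ α * (kummerPoly b j).eval (y ^ 2 / 4) := by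
    rw [hφ, eval_kummerPoly]
    congr 1
    refine Finset.sum_congr rfl fun m _ ↦ ?_
    rw [kummerCoeff]
    ring
  refine ⟨Real.sqrt (Real.exp (b - 1) / K) * Real.exp (R ^ 2), by positivity, ?_⟩
  intro j hj c hc hnorm y hy hyR
  have hj' : (0 : ℝ) < j := by exact_mod_cast hj
  have hintegral : (∫ y in Ioi (0 : ℝ), (c * φ j y) ^ 2 * w y) =
      c ^ 2 * (K * j.factorial / ∏ k ∈ Finset.range j, (b + (k : ℝ))) := by
    rw [hK, mul_assoc, mul_div_assoc, ← integral_sq_eval_kummerPoly hb0, ← integral_const_mul]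
    refine setIntegral_congr_fun measurableSet_Ioi fun x (hx : 0 < x) ↦ ?_
    have hpow : x ^ (2 * b - 1) = x ^ α * x ^ α * x ^ ((n : ℝ) - 2) := by
      rw [← Real.rpow_add hx, ← Real.rpow_add hx, hb]
      ring_nf
    simp only [hφP, hw, hpow]
    ring
  have hcsq : c ^ 2 ≤ Real.exp (b - 1) / K * (j : ℝ) ^ (b - 1) := by
    have hprod := prod_add_natCast_pos hb0 j
    have hfac : (0 : ℝ) < j.factorial := by positivity
    rw [hintegral, ← mul_div_assoc, div_eq_one_iff_eq hprod.ne'] at hnorm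
    have hle := prod_add_natCast_le hb1 hj
    rw [← hnorm, ← mul_assoc] at hle
    rw [div_mul_eq_mul_div, le_div_iff₀ hKpos]
    exact le_of_mul_le_mul_right hle hfac
  have hcle : c ≤ Real.sqrt (Real.exp (b - 1) / K) * (j : ℝ) ^ (((n : ℝ) - 3 + 2 * α) / 4) := by
    refine le_of_abs_le (abs_le_of_sq_le_sq ?_ (by positivity))
    rw [mul_pow, Real.sq_sqrt (by positivity), ← Real.rpow_mul_natCast hj'.le,
      show ((n : ℝ) - 3 + 2 * α) / 4 * (2 : ℕ) = b - 1 by rw [hb]; push_cast; ring]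
    exact hcsq
  have hP : |(kummerPoly b j).eval (y ^ 2 / 4)| ≤ Real.exp (R ^ 2) :=
    (abs_eval_kummerPoly_le hb1 hj (by positivity)).trans (Real.exp_le_exp.2 (by nlinarith))
  rw [hφP, abs_mul, abs_of_pos (Real.rpow_pos_of_pos hy α)]
  calc c * (y ^ α * |(kummerPoly b j).eval (y ^ 2 / 4)|)
      = c * |(kummerPoly b j).eval (y ^ 2 / 4)| * y ^ α := by ring
    _ ≤ Real.sqrt (Real.exp (b - 1) / K) * (j : ℝ) ^ (((n : ℝ) - 3 + 2 * α) / 4) *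
        Real.exp (R ^ 2) * y ^ α :=
      mul_le_mul_of_nonneg_right (mul_le_mul hcle hP (abs_nonneg _) (by positivity))
        (Real.rpow_nonneg hy.le α)
    _ = _ := by ring
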